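/- arXiv:0909.5577 — 8 statements merged into one kernel-verified Lean document; each statement's English description precedes it below -/
import Mathlib

section
/- Assume b_i ≥ 0 for every i ∈ {1,…,l}, so that the semidefinite packing problem (P) is feasible. Then (P) is bounded if and only if the range (column space) of C is contained in the range of Σ_{i=1}^l M_i. -/
open Matrix

open scoped MatrixOrder in
theorem aux_sqrt {n : ℕ} {A : Matrix (Fin n) (Fin n) ℝ} (hA : A.PosSemidef) :
    ∃ B : Matrix (Fin n) (Fin n) ℝ, A = Bᵀ * B := by
  obtain ⟨B, rfl⟩ := CStarAlgebra.nonneg_iff_eq_star_mul_self.mp hA.nonneg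
  exact ⟨B, by simp [star_eq_conjTranspose]⟩

theorem aux_factor {n : ℕ} (A L : Matrix (Fin n) (Fin n) ℝ)
    (h : ∀ v, A *ᵥ v = 0 → L *ᵥ v = 0) : ∃ E, L = E * A := by
  have hk : LinearMap.ker A.mulVecLin ≤ LinearMap.ker L.mulVecLin := by
    intro v hv
    simpa using h v (by simpa using hv)
  obtain ⟨g, hg⟩ := ((LinearMap.ker A.mulVecLin).liftQ A.mulVecLin le_rfl).exists_leftInverse_of_injective
    (Submodule.ker_liftQ_eq_bot _ _ _ le_rfl)
  refine ⟨LinearMap.toMatrix' (((LinearMap.ker A.mulVecLin).liftQ L.mulVecLin hk) ∘ₗ g), ?_⟩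
  apply Matrix.mulVec_injective
  funext v
  rw [← Matrix.mulVec_mulVec, LinearMap.toMatrix'_mulVec]
  have := LinearMap.congr_fun hg (Submodule.Quotient.mk v)
  simp only [LinearMap.comp_apply, Submodule.liftQ_apply, Matrix.mulVecLin_apply, LinearMap.id_apply] at this
  rw [LinearMap.comp_apply, this]
  simp

theorem aux_tr {n : ℕ} (A : Matrix (Fin n) (Fin n) ℝ) :
    (Aᵀ * A).trace = ∑ i, ∑ j, A i j ^ 2 := by
  rw [Finset.sum_comm]
  simp [Matrix.trace, Matrix.mul_apply, sq]

theorem aux_cs {n : ℕ} (A B : Matrix (Fin n) (Fin n) ℝ) :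
    ((A * B)ᵀ * (A * B)).trace ≤ (Aᵀ * A).trace * (Bᵀ * B).trace := by
  rw [aux_tr, aux_tr, aux_tr, Finset.sum_comm (f := fun i j => B i j ^ 2), Finset.sum_mul_sum]
  refine Finset.sum_le_sum fun i _ => Finset.sum_le_sum fun j _ => ?_
  rw [Matrix.mul_apply]
  exact Finset.sum_mul_sq_le_sq_mul_sq _ _ _

theorem aux_gram {n : ℕ} (A : Matrix (Fin n) (Fin n) ℝ) (v : Fin n → ℝ) :
    (Aᵀ * A) *ᵥ v = 0 ↔ A *ᵥ v = 0 := by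
  have := Matrix.conjTranspose_mul_self_mulVec_eq_zero A v
  simpa using this

theorem aux_ker {n : ℕ} {C S : Matrix (Fin n) (Fin n) ℝ} (hC : Cᵀ = C) (hS : Sᵀ = S) :
    LinearMap.range C.mulVecLin ≤ LinearMap.range S.mulVecLin ↔
      ∀ v, S *ᵥ v = 0 → C *ᵥ v = 0 := by
  constructor
  · intro h v hv
    have h0 : C *ᵥ v ⬝ᵥ C *ᵥ v = 0 := by
      have h1 : C *ᵥ v ⬝ᵥ C *ᵥ v = v ⬝ᵥ C *ᵥ (C *ᵥ v) := by
        rw [Matrix.dotProduct_mulVec v, ← Matrix.mulVec_transpose, hC]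
      obtain ⟨z, hz⟩ := h (LinearMap.mem_range_self C.mulVecLin (C *ᵥ v))
      simp only [Matrix.mulVecLin_apply] at hz
      rw [h1, ← hz, Matrix.dotProduct_mulVec, ← Matrix.mulVec_transpose, hS, hv, zero_dotProduct]
    exact dotProduct_self_eq_zero.mp h0
  · intro h
    obtain ⟨E, hE⟩ := aux_factor S C h
    have : C = S * Eᵀ := by
      rw [← hC, hE, Matrix.transpose_mul, hS]
    rintro _ ⟨v, rfl⟩
    exact ⟨Eᵀ *ᵥ v, by simp only [Matrix.mulVecLin_apply, Matrix.mulVec_mulVec, ← this]⟩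

theorem aux_quad {n : ℕ} {A : Matrix (Fin n) (Fin n) ℝ} (hA : A.PosSemidef) (v : Fin n → ℝ) :
    v ⬝ᵥ A *ᵥ v = 0 ↔ A *ᵥ v = 0 := by
  simpa using hA.dotProduct_mulVec_zero_iff v

/-- Assuming every `b i ≥ 0` (so that (P) is feasible), the semidefinite packing
problem (P) is bounded iff the range of `C` is contained in the range of `∑ i, M i`. -/
theorem stmt_1 (n l : ℕ) (C : Matrix (Fin n) (Fin n) ℝ)
    (M : Fin l → Matrix (Fin n) (Fin n) ℝ) (b : Fin l → ℝ)
    (hC : C.PosSemidef) (hM : ∀ i, (M i).PosSemidef) (hb : ∀ i, 0 ≤ b i) :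
    BddAbove {t : ℝ | ∃ X : Matrix (Fin n) (Fin n) ℝ,
        (X.PosSemidef ∧ ∀ i, (M i * X).trace ≤ b i) ∧ t = (C * X).trace} ↔
      LinearMap.range C.mulVecLin ≤ LinearMap.range (∑ i, M i).mulVecLin := by
  have hS : (∑ i, M i).PosSemidef := Matrix.posSemidef_sum _ fun i _ => hM i
  have symm : ∀ {A : Matrix (Fin n) (Fin n) ℝ}, A.PosSemidef → Aᵀ = A := fun h => by
    simpa using h.isHermitian.eq
  rw [aux_ker (symm hC) (symm hS)]
  constructor
  · rintro ⟨K, hK⟩ v hv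
    have hMv : ∀ i, v ⬝ᵥ M i *ᵥ v = 0 := by
      have h0 : ∑ i, v ⬝ᵥ M i *ᵥ v = 0 := by
        rw [← dotProduct_sum, ← Matrix.sum_mulVec, hv, dotProduct_zero]
      have := (Finset.sum_eq_zero_iff_of_nonneg (fun i _ => by
        simpa using (hM i).dotProduct_mulVec_nonneg v)).mp h0
      exact fun i => this i (Finset.mem_univ i)
    have htr : ∀ (A : Matrix (Fin n) (Fin n) ℝ) (t : ℝ),
        (A * (t • vecMulVec v v)).trace = t * (v ⬝ᵥ A *ᵥ v) := by
      intro A t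
      rw [Matrix.mul_smul, Matrix.trace_smul, Matrix.mul_vecMulVec, Matrix.trace_vecMulVec,
        dotProduct_comm, smul_eq_mul]
    have hb' : ∀ t : ℝ, 0 ≤ t → t * (v ⬝ᵥ C *ᵥ v) ≤ K := by
      intro t ht
      refine hK ⟨t • vecMulVec v v, ⟨?_, fun i => ?_⟩, (htr _ _).symm⟩
      · have := Matrix.posSemidef_vecMulVec_self_star v
        exact Matrix.PosSemidef.smul (by simpa using this) ht
      · rw [htr, hMv, mul_zero]; exact hb i
    rw [← aux_quad hC]
    have hnn : 0 ≤ v ⬝ᵥ C *ᵥ v := by simpa using hC.dotProduct_mulVec_nonneg v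
    by_contra hne
    have hpos : 0 < v ⬝ᵥ C *ᵥ v := lt_of_le_of_ne hnn (Ne.symm hne)
    have hK0 : 0 ≤ K := by simpa using hb' 0 le_rfl
    have := hb' ((K + 1) / (v ⬝ᵥ C *ᵥ v)) (by positivity)
    rw [div_mul_cancel₀ _ hne] at this
    linarith
  · intro h
    obtain ⟨R, hR⟩ := aux_sqrt hS
    obtain ⟨L, hL⟩ := aux_sqrt hC
    obtain ⟨E, hE⟩ := aux_factor R L (by
      intro v hv
      rw [← aux_gram, ← hL]
      apply h
      rw [hR, aux_gram, hv])
    refine ⟨(Eᵀ * E).trace * ∑ i, b i, ?_⟩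
    rintro _ ⟨X, ⟨hX, hXb⟩, rfl⟩
    obtain ⟨B, hB⟩ := aux_sqrt hX
    have key : ∀ Q : Matrix (Fin n) (Fin n) ℝ,
        (Qᵀ * Q * X).trace = ((Q * Bᵀ)ᵀ * (Q * Bᵀ)).trace := by
      intro Q
      rw [hB, ← Matrix.mul_assoc, Matrix.trace_mul_comm]
      simp [Matrix.mul_assoc]
    have h1 : ((∑ i, M i) * X).trace ≤ ∑ i, b i := by
      rw [Finset.sum_mul, Matrix.trace_sum]
      exact Finset.sum_le_sum fun i _ => hXb i
    have h2 : 0 ≤ (Eᵀ * E).trace := by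
      rw [aux_tr]; positivity
    calc (C * X).trace = ((E * (R * Bᵀ))ᵀ * (E * (R * Bᵀ))).trace := by
          rw [hL, key, hE, Matrix.mul_assoc]
      _ ≤ (Eᵀ * E).trace * ((R * Bᵀ)ᵀ * (R * Bᵀ)).trace := aux_cs _ _
      _ = (Eᵀ * E).trace * ((∑ i, M i) * X).trace := by rw [hR, key]
      _ ≤ _ := mul_le_mul_of_nonneg_left h1 h2
end

section
/- Assume b_i ≥ 0 for every i ∈ {1,…,l} and that the range of C is contained in the range of Σ_{i=1}^l M_i, so that the semidefinite packing problem (P) is feasible and bounded. If rank C = r, then (P) has an optimal solution of rank at most r: there exists a feasible symmetric positive semidefinite matrix X* with rank X* ≤ r such that ⟨C,X*⟩ ≥ ⟨C,X⟩ for every feasible X. -/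
open Matrix

lemma aux_factor_s3 {n : ℕ} {H : Matrix (Fin n) (Fin n) ℝ} (hH : H.PosSemidef) :
    ∃ A B : Matrix (Fin n) (Fin n) ℝ, Bᴴ * B = H ∧ (A * B)ᴴ = A * B ∧ B * (A * B) = B := by
  have hs := hH.1.spectral_theorem
  have hnn := hH.eigenvalues_nonneg
  set d := hH.1.eigenvalues with hd
  set U : Matrix (Fin n) (Fin n) ℝ := (hH.1.eigenvectorUnitary : Matrix (Fin n) (Fin n) ℝ) with hU
  have hUU : Uᴴ * U = 1 := Unitary.coe_star_mul_self hH.1.eigenvectorUnitary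
  have hs' : H = U * diagonal d * Uᴴ := by
    conv_lhs => rw [hs, Unitary.conjStarAlgAut_apply]
    rfl
  let s : Fin n → ℝ := fun i => √(d i)
  let t : Fin n → ℝ := fun i => (√(d i))⁻¹
  have hst : ∀ D : Matrix (Fin n) (Fin n) ℝ, Uᴴ * (U * D) = D := by
    intro D; rw [← Matrix.mul_assoc, hUU, Matrix.one_mul]
  have hS : (diagonal s)ᴴ = diagonal s := by simp [diagonal_conjTranspose]
  have hT : (diagonal t)ᴴ = diagonal t := by simp [diagonal_conjTranspose]
  refine ⟨U * diagonal t, diagonal s * Uᴴ, ?_, ?_, ?_⟩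
  · have : diagonal d = diagonal s * diagonal s := by
      rw [diagonal_mul_diagonal]; congr 1; ext i; exact (Real.mul_self_sqrt (hnn i)).symm
    rw [hs', this, conjTranspose_mul, conjTranspose_conjTranspose, hS]
    simp only [Matrix.mul_assoc]
  · have : diagonal t * diagonal s = diagonal s * diagonal t := by
      simp only [diagonal_mul_diagonal, mul_comm]
    simp only [conjTranspose_mul, conjTranspose_conjTranspose, hS, hT, Matrix.mul_assoc]
    rw [← Matrix.mul_assoc (diagonal s), ← this, Matrix.mul_assoc]
  · simp only [Matrix.mul_assoc, hst]
    rw [← Matrix.mul_assoc (diagonal t), ← Matrix.mul_assoc (diagonal s)]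
    congr 1
    simp only [diagonal_mul_diagonal]
    congr 1; ext i
    simp only [s, t]
    by_cases h : √(d i) = 0
    · simp [h]
    · field_simp

lemma aux_proj {n : ℕ} {H : Matrix (Fin n) (Fin n) ℝ} (hH : H.PosSemidef) :
    ∃ P : Matrix (Fin n) (Fin n) ℝ, Pᴴ = P ∧ P * P = P ∧ H * P = H ∧ P.rank ≤ H.rank := by
  obtain ⟨A, B, h1, h2, h3⟩ := aux_factor_s3 hH
  refine ⟨A * B, h2, ?_, ?_, ?_⟩
  · rw [Matrix.mul_assoc, h3]
  · rw [← h1, Matrix.mul_assoc, h3]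
  · rw [← h1, rank_conjTranspose_mul_self]
    exact rank_mul_le_right _ _

lemma aux_nonneg {n : ℕ} {H : Matrix (Fin n) (Fin n) ℝ} (hH : H.PosSemidef)
    (V : Matrix (Fin n) (Fin n) ℝ) : 0 ≤ (H * (V * Vᴴ)).trace := by
  rw [← Matrix.mul_assoc, trace_mul_comm, ← Matrix.mul_assoc]
  exact (hH.conjTranspose_mul_mul_same V).trace_nonneg

lemma aux_kill {n : ℕ} {H N : Matrix (Fin n) (Fin n) ℝ} (hH : H.PosSemidef)
    (h : (H * (N * Nᴴ)).trace = 0) : H * N = 0 := by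
  obtain ⟨A, B, h1, -, -⟩ := aux_factor_s3 hH
  have : ((B * N)ᴴ * (B * N)).trace = 0 := by
    rw [← h, ← h1, ← Matrix.mul_assoc _ N, trace_mul_comm _ Nᴴ, conjTranspose_mul]
    simp only [Matrix.mul_assoc]
  rw [trace_conjTranspose_mul_self_eq_zero_iff] at this
  rw [← h1, Matrix.mul_assoc, this, Matrix.mul_zero]

lemma aux_compact {n : ℕ} (β : ℝ) :
    IsCompact {W : Matrix (Fin n) (Fin n) ℝ | (Wᴴ * W).trace ≤ β} := by
  have hc : IsCompact {W : Matrix (Fin n) (Fin n) ℝ | ∀ i, W i ∈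
      {v : Fin n → ℝ | ∀ j, v j ∈ Set.Icc (-(β+1)) (β+1)}} :=
    isCompact_pi_infinite (fun _ => isCompact_pi_infinite (fun _ => isCompact_Icc))
  refine hc.of_isClosed_subset ?_ ?_
  · exact isClosed_le (by fun_prop) continuous_const
  · intro W hW i j
    have h1 : (Wᴴ * W).trace = ∑ a, ∑ c, W c a ^ 2 := by
      simp [trace, Matrix.mul_apply, sq]
    have h2 : W i j ^ 2 ≤ ∑ a, ∑ c, W c a ^ 2 :=
      (Finset.single_le_sum (f := fun c => W c j ^ 2) (fun _ _ => sq_nonneg _)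
        (Finset.mem_univ i)).trans
      (Finset.single_le_sum (f := fun a => ∑ c, W c a ^ 2)
        (fun _ _ => Finset.sum_nonneg fun _ _ => sq_nonneg _) (Finset.mem_univ j))
    have h3 : W i j ^ 2 ≤ β := h2.trans (h1 ▸ hW)
    constructor <;> nlinarith [sq_nonneg (W i j - 1), sq_nonneg (W i j + 1)]



/-- If (P) is feasible (`b ≥ 0`) and bounded (range of `C` contained in the range of
`∑ i, M i`) and `rank C = r`, then (P) has an optimal solution of rank at most `r`. -/
theorem stmt_3 (n l r : ℕ) (C : Matrix (Fin n) (Fin n) ℝ)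
    (M : Fin l → Matrix (Fin n) (Fin n) ℝ) (b : Fin l → ℝ)
    (hC : C.PosSemidef) (hM : ∀ i, (M i).PosSemidef) (hb : ∀ i, 0 ≤ b i)
    (hrange : LinearMap.range C.mulVecLin ≤ LinearMap.range (∑ i, M i).mulVecLin)
    (hr : C.rank = r) :
    ∃ X : Matrix (Fin n) (Fin n) ℝ,
      (X.PosSemidef ∧ ∀ i, (M i * X).trace ≤ b i) ∧ X.rank ≤ r ∧
      ∀ Y : Matrix (Fin n) (Fin n) ℝ, Y.PosSemidef → (∀ i, (M i * Y).trace ≤ b i) →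
        (C * Y).trace ≤ (C * X).trace := by
  have hCh : Cᴴ = C := hC.1
  set S := ∑ i, M i with hS
  have hSp : S.PosSemidef := posSemidef_sum _ (fun i _ => hM i)
  obtain ⟨A, B, hB, hQ, hBQ⟩ := aux_factor_s3 hSp
  set Q := A * B with hQd
  have hSQ : S * Q = S := by rw [← hB, Matrix.mul_assoc, hBQ]
  -- `M i * Q = M i`
  have hMQ : ∀ i, M i * Q = M i := by
    have h0 : ∑ i, (M i * ((1 - Q) * (1 - Q)ᴴ)).trace = 0 := by
      rw [← trace_sum, ← Finset.sum_mul, ← hS, ← Matrix.mul_assoc, Matrix.mul_sub, hSQ]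
      simp
    intro i
    have h1 := (Finset.sum_eq_zero_iff_of_nonneg
      (fun i _ => aux_nonneg (hM i) (1 - Q))).1 h0 i (Finset.mem_univ i)
    have h2 := aux_kill (hM i) h1
    rw [Matrix.mul_sub, Matrix.mul_one, sub_eq_zero] at h2
    exact h2.symm
  have hQS : Q * S = S := by
    have := congrArg conjTranspose hSQ
    rwa [conjTranspose_mul, hQ, hSp.1] at this
  have hQC : Q * C = C := by
    apply Matrix.ext_of_mulVec_single
    intro j
    obtain ⟨y, hy⟩ := hrange ⟨Pi.single j 1, rfl⟩
    simp only [mulVecLin_apply] at hy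
    rw [← mulVec_mulVec, ← hy, mulVec_mulVec, hQS]
  have hCQ : C * Q = C := by
    have := congrArg conjTranspose hQC
    rwa [conjTranspose_mul, hQ, hCh] at this
  have key : ∀ D V : Matrix (Fin n) (Fin n) ℝ, Dᴴ = D → D * Q = D →
      (D * ((Q * V) * (Q * V)ᴴ)).trace = (D * (V * Vᴴ)).trace := by
    intro D V hD hDQ
    have hQD : Q * D = D := by
      have := congrArg conjTranspose hDQ
      rwa [conjTranspose_mul, hQ, hD] at this
    rw [conjTranspose_mul, hQ]
    simp only [← Matrix.mul_assoc]
    rw [trace_mul_comm]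
    simp only [← Matrix.mul_assoc]
    rw [hQD, hDQ]
  -- the compact maximization
  let K : Set (Matrix (Fin n) (Fin n) ℝ) := {W | (Wᴴ * W).trace ≤ ∑ i, b i} ∩
    {W | ∀ i, (M i * ((A * W) * (A * W)ᴴ)).trace ≤ b i}
  have hK : IsCompact K := by
    refine (aux_compact _).inter_right ?_
    rw [Set.setOf_forall]
    exact isClosed_iInter fun i => isClosed_le (by fun_prop) continuous_const
  have hne : K.Nonempty :=
    ⟨0, by simpa using Finset.sum_nonneg fun i _ => hb i, by simpa using hb⟩
  obtain ⟨W, hWK, hWmax⟩ := hK.exists_isMaxOn hne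
    (f := fun W => (C * ((A * W) * (A * W)ᴴ)).trace) (by fun_prop)
  set V := A * W with hV
  obtain ⟨P, hP1, hP2, hP3, hP4⟩ := aux_proj (hC.conjTranspose_mul_mul_same V)
  have hX : (V * P) * (V * P)ᴴ = V * P * Vᴴ := by
    rw [conjTranspose_mul, hP1, Matrix.mul_assoc V, ← Matrix.mul_assoc P, hP2, Matrix.mul_assoc V]
  have hN : (V * (1 - P)) * (V * (1 - P))ᴴ = V * Vᴴ - V * P * Vᴴ := by
    have : (1 - P) * (1 - P)ᴴ = 1 - P := by
      rw [conjTranspose_sub, hP1, conjTranspose_one, Matrix.mul_sub, Matrix.sub_mul _ _ P, hP2]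
      simp
    rw [conjTranspose_mul, Matrix.mul_assoc V, ← Matrix.mul_assoc (1 - P), this]
    simp only [Matrix.sub_mul, Matrix.mul_sub, Matrix.one_mul, Matrix.mul_assoc]
  refine ⟨V * P * Vᴴ, ⟨?_, ?_⟩, ?_, ?_⟩
  · rw [← hX]; exact posSemidef_self_mul_conjTranspose _
  · intro i
    have h1 := aux_nonneg (hM i) (V * (1 - P))
    rw [hN, Matrix.mul_sub, trace_sub] at h1
    have h2 := hWK.2 i
    linarith
  · calc (V * P * Vᴴ).rank ≤ (V * P).rank := rank_mul_le_left _ _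
      _ ≤ P.rank := rank_mul_le_right _ _
      _ ≤ _ := hP4
      _ ≤ (Vᴴ * C).rank := rank_mul_le_left _ _
      _ ≤ C.rank := rank_mul_le_right _ _
      _ = r := hr
  · intro Y hY hYb
    have hXv : (C * (V * P * Vᴴ)).trace = (C * (V * Vᴴ)).trace := by
      have e1 : (C * (V * P * Vᴴ)).trace = (Vᴴ * C * V * P).trace := by
        rw [← Matrix.mul_assoc C, trace_mul_comm]
        simp only [Matrix.mul_assoc]
      have e2 : (C * (V * Vᴴ)).trace = (Vᴴ * C * V).trace := by
        rw [← Matrix.mul_assoc C, trace_mul_comm]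
        simp only [Matrix.mul_assoc]
      rw [e1, e2, hP3]
    obtain ⟨-, G, hG, -, -⟩ := aux_factor_s3 hY
    have hG' : Y = Gᴴ * (Gᴴ)ᴴ := by rw [conjTranspose_conjTranspose, hG]
    have hAB : A * (B * Gᴴ) = Q * Gᴴ := by rw [← Matrix.mul_assoc]
    have hmem : B * Gᴴ ∈ K := by
      refine ⟨?_, ?_⟩
      · show ((B * Gᴴ)ᴴ * (B * Gᴴ)).trace ≤ _
        have : ((B * Gᴴ)ᴴ * (B * Gᴴ)).trace = ∑ i, (M i * Y).trace := by
          rw [← trace_sum, ← Finset.sum_mul, ← hS, ← hB, hG', conjTranspose_mul,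
            ← Matrix.mul_assoc _ Gᴴ, trace_mul_comm _ (Gᴴᴴ)]
          simp only [Matrix.mul_assoc]
        rw [this]
        exact Finset.sum_le_sum fun i _ => hYb i
      · intro i
        rw [hAB, key _ _ (hM i).1 (hMQ i), ← hG']
        exact hYb i
    have h1 := hWmax hmem
    simp only [Set.mem_setOf_eq] at h1
    rw [hAB, key _ _ hCh hCQ, ← hG'] at h1
    rw [hXv]
    exact h1
end

section
/- Assume b_i ≥ 0 for every i ∈ {1,…,l} and that the range of C is contained in the range of Σ_{i=1}^l M_i. Then the reduced problem (P') is strictly feasible and its dual is strictly feasible: (i) there exists a symmetric positive definite n'×n' matrix Z̄ with ⟨M_i', Z̄⟩ < b_i for all i ∈ I; and (ii) there exist reals μ̄_i > 0 (i ∈ I) such that Σ_{i∈I} μ̄_i M_i' − C' is positive definite. -/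
open Matrix

theorem aux_dom {m : ℕ} (A C : Matrix (Fin m) (Fin m) ℝ) (hA : A.PosDef) (hC : C.IsHermitian) :
    ∃ t : ℝ, 0 < t ∧ (t • A - C).PosDef := by
  have hpos : ∀ x : Fin m → ℝ, x ≠ 0 → 0 < x ⬝ᵥ (A *ᵥ x) := by
    intro x hx
    have := hA.dotProduct_mulVec_pos hx
    simpa using this
  have hcont : ContinuousOn (fun x : Fin m → ℝ => (x ⬝ᵥ (C *ᵥ x)) / (x ⬝ᵥ (A *ᵥ x)))
      (Metric.sphere 0 1) := by
    apply ContinuousOn.div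
    · exact Continuous.continuousOn (by fun_prop)
    · exact Continuous.continuousOn (by fun_prop)
    · intro x hx
      exact (hpos x (by rintro rfl; simp at hx)).ne'
  obtain ⟨K, hK⟩ := (isCompact_sphere (0 : Fin m → ℝ) 1).bddAbove_image hcont
  refine ⟨max K 0 + 1, by positivity, ?_⟩
  refine Matrix.PosDef.of_dotProduct_mulVec_pos ?_ ?_
  · exact (hA.isHermitian.smul (by simp [IsSelfAdjoint])).sub hC
  · intro x hx
    have hn : 0 < ‖x‖ := norm_pos_iff.mpr hx
    have h1 : (‖x‖⁻¹ • x) ∈ Metric.sphere (0 : Fin m → ℝ) 1 := by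
      simp [norm_smul, hn.ne']
    have h2 := hK (Set.mem_image_of_mem _ h1)
    have h3 := hpos x hx
    have h4 : (x ⬝ᵥ (C *ᵥ x)) / (x ⬝ᵥ (A *ᵥ x)) ≤ K := by
      simp only [mulVec_smul, dotProduct_smul, smul_dotProduct, smul_eq_mul] at h2
      rwa [mul_div_mul_left _ _ (by positivity), mul_div_mul_left _ _ (by positivity)] at h2
    rw [div_le_iff₀ h3] at h4
    have h5 : K * (x ⬝ᵥ (A *ᵥ x)) ≤ max K 0 * (x ⬝ᵥ (A *ᵥ x)) := by
      gcongr
      exact le_max_left _ _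
    simp only [star_trivial, sub_mulVec, smul_mulVec, dotProduct_sub, dotProduct_smul, smul_eq_mul]
    linarith

/-- Under the feasibility and boundedness conditions, the reduced semidefinite packing
problem (P') is strictly feasible and its Lagrangian dual is strictly feasible. -/
theorem stmt_5 (n l n0 n' : ℕ) (C : Matrix (Fin n) (Fin n) ℝ)
    (M : Fin l → Matrix (Fin n) (Fin n) ℝ) (b : Fin l → ℝ)
    (hC : C.PosSemidef) (hM : ∀ i, (M i).PosSemidef) (hb : ∀ i, 0 ≤ b i)
    (hrange : LinearMap.range C.mulVecLin ≤ LinearMap.range (∑ i, M i).mulVecLin)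
    (U : Matrix (Fin n) (Fin n0) ℝ) (V : Matrix (Fin n0) (Fin n') ℝ)
    (hU : Uᵀ * U = 1)
    (hUrange : LinearMap.range U.mulVecLin = LinearMap.range (∑ i, M i).mulVecLin)
    (hV : Vᵀ * V = 1)
    (hVrange : LinearMap.range V.mulVecLin =
      LinearMap.ker (Uᵀ * (∑ i ∈ Finset.univ.filter fun i => b i = 0, M i) * U).mulVecLin) :
    (∃ Z : Matrix (Fin n') (Fin n') ℝ, Z.PosDef ∧
      ∀ i ∈ Finset.univ.filter fun i => b i ≠ 0,
        (((U * V)ᵀ * M i * (U * V)) * Z).trace < b i) ∧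
    (∃ μ : Fin l → ℝ, (∀ i ∈ Finset.univ.filter fun i => b i ≠ 0, 0 < μ i) ∧
      ((∑ i ∈ Finset.univ.filter fun i => b i ≠ 0, μ i • ((U * V)ᵀ * M i * (U * V))) -
        (U * V)ᵀ * C * (U * V)).PosDef) := by
  have hM' : ∀ i, ((U * V)ᵀ * M i * (U * V)).PosSemidef := by
    intro i
    have := (hM i).conjTranspose_mul_mul_same (U * V)
    simpa only [conjTranspose_eq_transpose_of_trivial] using this
  have hC' : ((U * V)ᵀ * C * (U * V)).PosSemidef := by
    have := hC.conjTranspose_mul_mul_same (U * V)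
    simpa only [conjTranspose_eq_transpose_of_trivial] using this
  have hq : ∀ (N : Matrix (Fin n) (Fin n) ℝ) (x : Fin n' → ℝ),
      x ⬝ᵥ (((U * V)ᵀ * N * (U * V)) *ᵥ x) =
        ((U * V) *ᵥ x) ⬝ᵥ (N *ᵥ ((U * V) *ᵥ x)) := by
    intro N x
    rw [Matrix.mul_assoc, ← mulVec_mulVec, dotProduct_mulVec, vecMul_transpose]; simp only [mulVec_mulVec]
  constructor
  · have hev : ∀ᶠ ε : ℝ in nhdsWithin 0 (Set.Ioi 0), ∀ i : Fin l, b i ≠ 0 →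
        ε * ((U * V)ᵀ * M i * (U * V)).trace < b i := by
      rw [Filter.eventually_all]
      intro i
      by_cases hi : b i = 0
      · simp [hi]
      · have hbi : 0 < b i := lt_of_le_of_ne (hb i) (Ne.symm hi)
        have hc : Continuous fun ε : ℝ => ε * ((U * V)ᵀ * M i * (U * V)).trace := by fun_prop
        have := (hc.tendsto 0).eventually_lt_const (u := b i) (by simpa using hbi)
        exact (this.filter_mono nhdsWithin_le_nhds).mono fun _ h _ => h
    obtain ⟨ε, h1, h2⟩ := (hev.and self_mem_nhdsWithin).exists
    refine ⟨ε • 1, Matrix.PosDef.one.smul h2, ?_⟩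
    intro i hi
    simp only [Finset.mem_filter, Finset.mem_univ, true_and] at hi
    simpa [Matrix.mul_smul, trace_smul] using h1 i hi
  · have hApsd : (∑ i ∈ Finset.univ.filter fun i => b i ≠ 0,
        ((U * V)ᵀ * M i * (U * V))).PosSemidef :=
      posSemidef_sum _ fun i _ => hM' i
    have hS : (∑ i, M i).PosSemidef := posSemidef_sum _ fun i _ => hM i
    have hA : (∑ i ∈ Finset.univ.filter fun i => b i ≠ 0,
        ((U * V)ᵀ * M i * (U * V))).PosDef := by
      refine Matrix.PosDef.of_dotProduct_mulVec_pos hApsd.isHermitian ?_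
      intro x hx
      refine lt_of_le_of_ne (hApsd.dotProduct_mulVec_nonneg x) ?_
      intro h0
      apply hx
      simp only [star_trivial] at h0
      rw [← Matrix.sum_mul, ← Matrix.mul_sum, hq] at h0
      have hk : V *ᵥ x ∈ LinearMap.ker
          (Uᵀ * (∑ i ∈ Finset.univ.filter fun i => b i = 0, M i) * U).mulVecLin := by
        rw [← hVrange]; exact ⟨x, rfl⟩
      rw [LinearMap.mem_ker, mulVecLin_apply] at hk
      have h0' : ((U * V) *ᵥ x) ⬝ᵥ ((∑ i ∈ Finset.univ.filter fun i => b i = 0, M i) *ᵥ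
          ((U * V) *ᵥ x)) = 0 := by
        rw [← hq]
        have : (U * V)ᵀ * (∑ i ∈ Finset.univ.filter fun i => b i = 0, M i) * (U * V) =
          Vᵀ * ((Uᵀ * (∑ i ∈ Finset.univ.filter fun i => b i = 0, M i) * U) * V) := by
          simp only [transpose_mul, Matrix.mul_assoc]
        rw [this, ← mulVec_mulVec, ← mulVec_mulVec, hk]
        simp
      have hsum : (∑ i, M i) = (∑ i ∈ Finset.univ.filter fun i => b i = 0, M i) +
          ∑ i ∈ Finset.univ.filter fun i => b i ≠ 0, M i :=
        (Finset.sum_filter_add_sum_filter_not _ _ _).symm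
      set y := (U * V) *ᵥ x with hy
      have hSy : (∑ i, M i) *ᵥ y = 0 := by
        rw [← hS.dotProduct_mulVec_zero_iff, hsum, star_trivial, add_mulVec, dotProduct_add,
          h0', ← h0, add_zero]
      have hyr : y ∈ LinearMap.range (∑ i, M i).mulVecLin := by
        rw [← hUrange]
        exact ⟨V *ᵥ x, by simp [hy]⟩
      obtain ⟨w, hw⟩ := hyr
      rw [mulVecLin_apply] at hw
      have hyy : y ⬝ᵥ y = 0 := by
        have hT : (∑ i, M i)ᵀ = ∑ i, M i := by
          simpa only [conjTranspose_eq_transpose_of_trivial] using hS.isHermitian.eq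
        calc y ⬝ᵥ y = y ⬝ᵥ ((∑ i, M i) *ᵥ w) := by rw [hw]
          _ = ((∑ i, M i)ᵀ *ᵥ y) ⬝ᵥ w := by rw [dotProduct_mulVec, mulVec_transpose]
          _ = 0 := by rw [hT, hSy, zero_dotProduct]
      have hy0 : y = 0 := dotProduct_self_eq_zero.mp hyy
      have hW : (U * V)ᵀ * (U * V) = 1 := by
        rw [transpose_mul, Matrix.mul_assoc, ← Matrix.mul_assoc Uᵀ, hU, Matrix.one_mul, hV]
      calc x = ((U * V)ᵀ * (U * V)) *ᵥ x := by rw [hW, one_mulVec]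
        _ = 0 := by rw [← mulVec_mulVec, ← hy, hy0, mulVec_zero]
    obtain ⟨t, ht, h⟩ := aux_dom _ _ hA hC'.isHermitian
    refine ⟨fun _ => t, fun _ _ => ht, ?_⟩
    rwa [← Finset.smul_sum]
end

section
/- Assume b_i ≥ 0 for every i ∈ {1,…,l} and that the range of C is contained in the range of Σ_{i=1}^l M_i. If Z is an optimal solution of the reduced problem (P'), then X := (UV)Z(UV)ᵀ is an optimal solution of the semidefinite packing problem (P); moreover rank X ≤ rank Z and ⟨C,X⟩ = ⟨C',Z⟩. -/
open Matrix

lemma aux_proj_s6 {m k p : ℕ} (Q : Matrix (Fin m) (Fin k) ℝ) (A : Matrix (Fin m) (Fin p) ℝ)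
    (hQ : Qᵀ * Q = 1)
    (h : LinearMap.range A.mulVecLin ≤ LinearMap.range Q.mulVecLin) : Q * Qᵀ * A = A := by
  apply Matrix.ext_of_mulVec_single
  intro j
  obtain ⟨w, hw⟩ := h (LinearMap.mem_range_self A.mulVecLin (Pi.single j 1))
  simp only [Matrix.mulVecLin_apply] at hw
  rw [← Matrix.mulVec_mulVec, ← hw, Matrix.mulVec_mulVec, Matrix.mul_assoc, hQ, Matrix.mul_one]

lemma aux_psd {m : ℕ} {A B : Matrix (Fin m) (Fin m) ℝ} (hA : A.PosSemidef) (hB : B.PosSemidef) :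
    0 ≤ (A * B).trace ∧ ((A * B).trace = 0 → A * B = 0) := by
  obtain ⟨R, rfl⟩ : ∃ R : Matrix (Fin m) (Fin m) ℝ, A = Rᴴ * R := by
    open scoped MatrixOrder ComplexOrder in
    exact CStarAlgebra.nonneg_iff_eq_star_mul_self.mp hA.nonneg
  obtain ⟨T, rfl⟩ : ∃ R : Matrix (Fin m) (Fin m) ℝ, B = Rᴴ * R := by
    open scoped MatrixOrder ComplexOrder in
    exact CStarAlgebra.nonneg_iff_eq_star_mul_self.mp hB.nonneg
  have e : (Rᴴ * R * (Tᴴ * T)).trace = ((R * Tᴴ)ᴴ * (R * Tᴴ)).trace := by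
    rw [conjTranspose_mul, conjTranspose_conjTranspose,
      show Rᴴ * R * (Tᴴ * T) = (Rᴴ * R * Tᴴ) * T by simp only [Matrix.mul_assoc],
      Matrix.trace_mul_comm]
    simp only [Matrix.mul_assoc]
  rw [e]
  refine ⟨(posSemidef_conjTranspose_mul_self _).trace_nonneg, fun h => ?_⟩
  have h0 := Matrix.trace_conjTranspose_mul_self_eq_zero_iff.mp h
  rw [show Rᴴ * R * (Tᴴ * T) = Rᴴ * (R * Tᴴ) * T by simp only [Matrix.mul_assoc], h0]
  simp

lemma aux_conj {m k : ℕ} {A : Matrix (Fin m) (Fin m) ℝ} (hA : A.PosSemidef)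
    (Q : Matrix (Fin m) (Fin k) ℝ) : (Qᵀ * A * Q).PosSemidef := by
  simpa using hA.conjTranspose_mul_mul_same Q

lemma aux_tr_s6 {m : ℕ} {A : Matrix (Fin m) (Fin m) ℝ} (hA : A.PosSemidef) : Aᵀ = A := by
  simpa using hA.1.eq

lemma aux_cyc {m k : ℕ} (A : Matrix (Fin m) (Fin m) ℝ) (Q : Matrix (Fin m) (Fin k) ℝ)
    (Z : Matrix (Fin k) (Fin k) ℝ) :
    (A * (Q * Z * Qᵀ)).trace = ((Qᵀ * A * Q) * Z).trace := by
  rw [show A * (Q * Z * Qᵀ) = (A * Q * Z) * Qᵀ by simp only [Matrix.mul_assoc],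
    Matrix.trace_mul_comm]
  simp only [Matrix.mul_assoc]

/-- If `Z` is an optimal solution of the reduced problem (P'), then
`X := (U*V) * Z * (U*V)ᵀ` is an optimal solution of the semidefinite packing problem (P);
moreover `rank X ≤ rank Z` and `⟨C,X⟩ = ⟨C',Z⟩`. -/
theorem stmt_6 (n l n0 n' : ℕ) (C : Matrix (Fin n) (Fin n) ℝ)
    (M : Fin l → Matrix (Fin n) (Fin n) ℝ) (b : Fin l → ℝ)
    (hC : C.PosSemidef) (hM : ∀ i, (M i).PosSemidef) (hb : ∀ i, 0 ≤ b i)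
    (hrange : LinearMap.range C.mulVecLin ≤ LinearMap.range (∑ i, M i).mulVecLin)
    (U : Matrix (Fin n) (Fin n0) ℝ) (V : Matrix (Fin n0) (Fin n') ℝ)
    (hU : Uᵀ * U = 1)
    (hUrange : LinearMap.range U.mulVecLin = LinearMap.range (∑ i, M i).mulVecLin)
    (hV : Vᵀ * V = 1)
    (hVrange : LinearMap.range V.mulVecLin =
      LinearMap.ker (Uᵀ * (∑ i ∈ Finset.univ.filter fun i => b i = 0, M i) * U).mulVecLin)
    (Z : Matrix (Fin n') (Fin n') ℝ)
    (hZfeas : Z.PosSemidef ∧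
      ∀ i ∈ Finset.univ.filter fun i => b i ≠ 0,
        (((U * V)ᵀ * M i * (U * V)) * Z).trace ≤ b i)
    (hZopt : ∀ W : Matrix (Fin n') (Fin n') ℝ, W.PosSemidef →
      (∀ i ∈ Finset.univ.filter fun i => b i ≠ 0,
        (((U * V)ᵀ * M i * (U * V)) * W).trace ≤ b i) →
      (((U * V)ᵀ * C * (U * V)) * W).trace ≤ (((U * V)ᵀ * C * (U * V)) * Z).trace) :
    (((U * V) * Z * (U * V)ᵀ).PosSemidef ∧
      ∀ i, (M i * ((U * V) * Z * (U * V)ᵀ)).trace ≤ b i) ∧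
    (∀ Y : Matrix (Fin n) (Fin n) ℝ, Y.PosSemidef → (∀ i, (M i * Y).trace ≤ b i) →
      (C * Y).trace ≤ (C * ((U * V) * Z * (U * V)ᵀ)).trace) ∧
    ((U * V) * Z * (U * V)ᵀ).rank ≤ Z.rank ∧
    (C * ((U * V) * Z * (U * V)ᵀ)).trace = (((U * V)ᵀ * C * (U * V)) * Z).trace := by
  set S := ∑ i, M i with hS
  have hPS : U * Uᵀ * S = S := aux_proj_s6 U S hU hUrange.ge
  have hPC : U * Uᵀ * C = C := aux_proj_s6 U C hU (hrange.trans hUrange.ge)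
  have hPt : (U * Uᵀ)ᵀ = U * Uᵀ := by simp
  have hSpsd : S.PosSemidef := Matrix.posSemidef_sum _ fun i _ => hM i
  have hSP : S * (U * Uᵀ) = S := by
    have := congrArg Matrix.transpose hPS
    rwa [Matrix.transpose_mul, hPt, aux_tr_s6 hSpsd] at this
  have hPP : U * Uᵀ * (U * Uᵀ) = U * Uᵀ := by
    rw [Matrix.mul_assoc, ← Matrix.mul_assoc Uᵀ U, hU, Matrix.one_mul]
  have hQpsd : (1 - U * Uᵀ).PosSemidef := by
    have := posSemidef_conjTranspose_mul_self (1 - U * Uᵀ)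
    rw [conjTranspose_eq_transpose_of_trivial, Matrix.transpose_sub, hPt, Matrix.transpose_one,
      Matrix.mul_sub, Matrix.sub_mul, Matrix.sub_mul, hPP] at this
    simpa using this
  have hMP : ∀ i, M i * (U * Uᵀ) = M i := by
    have h0 : ∑ i, (M i * (1 - U * Uᵀ)).trace = 0 := by
      rw [← Matrix.trace_sum, ← Finset.sum_mul, ← hS, Matrix.mul_sub, hSP]
      simp
    intro i
    have h1 := (Finset.sum_eq_zero_iff_of_nonneg
      fun i _ => (aux_psd (hM i) hQpsd).1).mp h0 i (Finset.mem_univ i)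
    have h2 := (aux_psd (hM i) hQpsd).2 h1
    rw [Matrix.mul_sub, Matrix.mul_one, sub_eq_zero] at h2
    exact h2.symm
  -- both-sided projection
  have both : ∀ A : Matrix (Fin n) (Fin n) ℝ, A * (U * Uᵀ) = A → Aᵀ = A →
      ∀ Y : Matrix (Fin n) (Fin n) ℝ,
      (A * Y).trace = ((Uᵀ * A * U) * (Uᵀ * Y * U)).trace := by
    intro A hA hAt Y
    have hA' : U * Uᵀ * A = A := by
      have := congrArg Matrix.transpose hA
      rwa [Matrix.transpose_mul, hPt, hAt] at this
    rw [← aux_cyc, show A * (U * (Uᵀ * Y * U) * Uᵀ) = (A * (U * Uᵀ)) * Y * (U * Uᵀ) by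
      simp only [Matrix.mul_assoc], hA, Matrix.trace_mul_comm (A * Y), ← Matrix.mul_assoc, hA']
  have hCP : C * (U * Uᵀ) = C := by
    have := congrArg Matrix.transpose hPC
    rwa [Matrix.transpose_mul, hPt, aux_tr_s6 hC] at this
  set T := ∑ i ∈ Finset.univ.filter fun i => b i = 0, M i with hT
  have hTpsd : T.PosSemidef := Matrix.posSemidef_sum _ fun i _ => hM i
  have hTP : T * (U * Uᵀ) = T := by
    rw [hT, Finset.sum_mul]
    exact Finset.sum_congr rfl fun i _ => hMP i
  have hNV : Uᵀ * T * U * V = 0 := by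
    apply Matrix.ext_of_mulVec_single
    intro j
    have : V.mulVecLin (Pi.single j 1) ∈ LinearMap.ker (Uᵀ * T * U).mulVecLin := by
      rw [← hVrange]
      exact LinearMap.mem_range_self _ _
    rw [LinearMap.mem_ker, Matrix.mulVecLin_apply, Matrix.mulVecLin_apply,
      Matrix.mulVec_mulVec] at this
    rw [this, Matrix.zero_mulVec]
  have hX : ((U * V) * Z * (U * V)ᵀ).PosSemidef := by
    simpa using aux_conj hZfeas.1 (U * V)ᵀ
  refine ⟨⟨hX, ?_⟩, ?_, ?_, aux_cyc _ _ _⟩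
  · intro i
    by_cases hi : b i = 0
    · have h0 : (T * ((U * V) * Z * (U * V)ᵀ)).trace = 0 := by
        rw [aux_cyc, show (U * V)ᵀ * T * (U * V) = Vᵀ * (Uᵀ * T * U * V) by
          simp only [Matrix.transpose_mul, Matrix.mul_assoc], hNV]
        simp
      rw [hT, Finset.sum_mul, Matrix.trace_sum] at h0
      have := (Finset.sum_eq_zero_iff_of_nonneg
        fun i _ => (aux_psd (hM i) hX).1).mp h0 i (by simp [hi])
      rw [this, hi]
    · rw [aux_cyc]
      exact hZfeas.2 i (by simp [hi])
  · intro Y hY hYf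
    have hW := aux_conj hY U
    have hNW : Uᵀ * T * U * (Uᵀ * Y * U) = 0 := by
      apply (aux_psd (aux_conj hTpsd U) hW).2
      apply le_antisymm _ (aux_psd (aux_conj hTpsd U) hW).1
      rw [← both T hTP (aux_tr_s6 hTpsd), hT, Finset.sum_mul, Matrix.trace_sum]
      apply Finset.sum_nonpos
      intro i hi
      have hi' : b i = 0 := by simpa using hi
      exact hi' ▸ hYf i
    set W := Uᵀ * Y * U with hWdef
    have hVW : V * Vᵀ * W = W := by
      apply aux_proj_s6 V W hV
      rw [hVrange]
      rintro _ ⟨x, rfl⟩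
      rw [LinearMap.mem_ker, Matrix.mulVecLin_apply, Matrix.mulVecLin_apply,
        Matrix.mulVec_mulVec, hNW, Matrix.zero_mulVec]
    have hWV : W * (V * Vᵀ) = W := by
      have := congrArg Matrix.transpose hVW
      rwa [Matrix.transpose_mul, aux_tr_s6 hW, Matrix.transpose_mul,
        Matrix.transpose_transpose] at this
    have key : ∀ A : Matrix (Fin n) (Fin n) ℝ, A * (U * Uᵀ) = A → Aᵀ = A →
        (((U * V)ᵀ * A * (U * V)) * (Vᵀ * W * V)).trace = (A * Y).trace := by
      intro A hA hAt
      rw [both A hA hAt Y, ← hWdef,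
        show (U * V)ᵀ * A * (U * V) = Vᵀ * (Uᵀ * A * U) * V by
          simp only [Matrix.transpose_mul, Matrix.mul_assoc], ← aux_cyc,
        show V * (Vᵀ * W * V) * Vᵀ = V * Vᵀ * W * (V * Vᵀ) by
          simp only [Matrix.mul_assoc], hVW, hWV]
    rw [aux_cyc, ← key C hCP (aux_tr_s6 hC)]
    apply hZopt _ (aux_conj hW V)
    intro i _
    rw [key _ (hMP i) (aux_tr_s6 (hM i))]
    exact hYf i
  · exact (Matrix.rank_mul_le_left _ _).trans (Matrix.rank_mul_le_right _ _)
end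

section
/- Let P and C be real symmetric n×n matrices with P positive definite and rank C = r, and let X be a real symmetric positive semidefinite n×n matrix such that (P − C)X = 0. Then rank X ≤ r. (Indeed rank(P − C) ≥ n − r, so the columns of X lie in a subspace of dimension at most r.) -/
open Matrix

/-- If `P` is symmetric positive definite, `C` is symmetric of rank `r`, `X` is positive
semidefinite and `(P - C) * X = 0`, then `rank (P - C) ≥ n - r` and `rank X ≤ r`. -/
theorem stmt_7 (n r : ℕ) (P C X : Matrix (Fin n) (Fin n) ℝ)
    (hP : P.PosDef) (hCsymm : C.IsSymm) (hr : C.rank = r)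
    (hX : X.PosSemidef) (h : (P - C) * X = 0) :
    n - r ≤ (P - C).rank ∧ X.rank ≤ r := by
  have hu : IsUnit P := hP.isUnit
  have hdet : IsUnit P.det := (Matrix.isUnit_iff_isUnit_det P).1 hu
  constructor
  · have h1 : P.rank = n := by simpa using Matrix.rank_of_isUnit P hu
    have h2 : ((P - C) + C).rank ≤ (P - C).rank + C.rank := by
      unfold Matrix.rank
      refine le_trans (Submodule.finrank_mono ?_)
        (Submodule.finrank_add_le_finrank_add_finrank _ _)
      rintro _ ⟨v, rfl⟩
      rw [Matrix.mulVecLin_add, LinearMap.add_apply]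
      exact Submodule.add_mem_sup ⟨v, rfl⟩ ⟨v, rfl⟩
    rw [sub_add_cancel] at h2
    omega
  · have h3 : P * X = C * X := by
      rw [Matrix.sub_mul] at h
      exact sub_eq_zero.1 h
    have h4 : (P * X).rank = X.rank := Matrix.rank_mul_eq_right_of_isUnit_det P X hdet
    rw [← h4, h3, ← hr]
    exact Matrix.rank_mul_le_left C X
end

section
/- Assume the combined semidefinite packing problem (P_CMB) has a feasible triple and a dual feasible vector exists. If rank C = r, then there exists a sequence (X_k, Y_k, λ_k), k ∈ ℕ, of feasible triples for (P_CMB) such that rank X_k ≤ r for all k and the objective values ⟨C,X_k⟩ + ⟨R_0,Y_k⟩ + h_0ᵀλ_k converge, as k → ∞, to the supremum of the objective over all feasible triples. -/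
open Matrix Filter

open scoped MatrixOrder in
lemma aux_sq {n : ℕ} {A : Matrix (Fin n) (Fin n) ℝ} (hA : A.PosSemidef) :
    ∃ B : Matrix (Fin n) (Fin n) ℝ, A = Bᴴ * B :=
  CStarAlgebra.nonneg_iff_eq_star_mul_self.mp hA.nonneg

lemma aux_tr_s9 {n : ℕ} {A B : Matrix (Fin n) (Fin n) ℝ} (hA : A.PosSemidef) (hB : B.PosSemidef) :
    0 ≤ (A * B).trace := by
  obtain ⟨D, rfl⟩ := aux_sq hB
  rw [← Matrix.mul_assoc, Matrix.trace_mul_comm, ← Matrix.mul_assoc]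
  exact (hA.mul_mul_conjTranspose_same D).trace_nonneg

lemma aux_proj_s9 {n : ℕ} {S : Matrix (Fin n) (Fin n) ℝ} (hS : S.IsHermitian) :
    ∃ P : Matrix (Fin n) (Fin n) ℝ, P.PosSemidef ∧ (1 - P).PosSemidef ∧ S * P = S ∧
      P.rank ≤ S.rank := by
  obtain ⟨U, d, hU, hU2, hSd⟩ : ∃ (U : Matrix (Fin n) (Fin n) ℝ) (d : Fin n → ℝ),
      Uᴴ * U = 1 ∧ U * Uᴴ = 1 ∧ S = U * diagonal d * Uᴴ := by
    refine ⟨hS.eigenvectorUnitary, hS.eigenvalues, ?_, ?_, ?_⟩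
    · exact Unitary.coe_star_mul_self hS.eigenvectorUnitary
    · exact Unitary.coe_mul_star_self hS.eigenvectorUnitary
    · have := hS.spectral_theorem
      rw [Unitary.conjStarAlgAut_apply] at this
      exact this
  have hD : diagonal d = Uᴴ * S * U := by
    rw [hSd]
    calc diagonal d = (Uᴴ * U) * diagonal d * (Uᴴ * U) := by rw [hU]; simp
      _ = _ := by simp only [Matrix.mul_assoc]
  have e1 : (1 : Matrix (Fin n) (Fin n) ℝ) - U * diagonal (fun i => d i * (d i)⁻¹) * Uᴴ
      = U * diagonal (fun i => 1 - d i * (d i)⁻¹) * Uᴴ := by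
    have : diagonal (fun i => 1 - d i * (d i)⁻¹) = 1 - diagonal (fun i => d i * (d i)⁻¹) := by
      rw [← diagonal_one, diagonal_sub]
    rw [this, Matrix.mul_sub, Matrix.sub_mul, Matrix.mul_one, hU2]
  refine ⟨U * diagonal (fun i => d i * (d i)⁻¹) * Uᴴ, ?_, ?_, ?_, ?_⟩
  · refine PosSemidef.mul_mul_conjTranspose_same (PosSemidef.diagonal ?_) U
    intro i
    by_cases hi : d i = 0 <;> simp [hi]
  · rw [e1]
    refine PosSemidef.mul_mul_conjTranspose_same (PosSemidef.diagonal ?_) U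
    intro i
    by_cases hi : d i = 0 <;> simp [hi]
  · rw [hSd]
    calc _ = U * (diagonal d * (Uᴴ * U) * diagonal (fun i => d i * (d i)⁻¹)) * Uᴴ := by
          simp only [Matrix.mul_assoc]
      _ = _ := by
          rw [hU, Matrix.mul_one, diagonal_mul_diagonal]
          congr 3
          ext i
          by_cases hi : d i = 0 <;> simp [hi]
  · have : diagonal (fun i => d i * (d i)⁻¹) = diagonal d * diagonal (fun i => (d i)⁻¹) := by
      rw [diagonal_mul_diagonal]
    rw [this, hD]
    calc _ ≤ (U * (Uᴴ * S * U * diagonal (fun i => (d i)⁻¹))).rank := rank_mul_le_left _ _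
      _ ≤ (Uᴴ * S * U * diagonal (fun i => (d i)⁻¹)).rank := rank_mul_le_right _ _
      _ ≤ (Uᴴ * S * U).rank := rank_mul_le_left _ _
      _ ≤ (Uᴴ * S).rank := rank_mul_le_left _ _
      _ ≤ _ := rank_mul_le_right _ _

lemma aux_red {n : ℕ} {C X : Matrix (Fin n) (Fin n) ℝ} (hC : C.PosSemidef) (hX : X.PosSemidef) :
    ∃ X' : Matrix (Fin n) (Fin n) ℝ, X'.PosSemidef ∧ X'.rank ≤ C.rank ∧
      (C * X').trace = (C * X).trace ∧
      ∀ M : Matrix (Fin n) (Fin n) ℝ, M.PosSemidef → (M * X').trace ≤ (M * X).trace := by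
  obtain ⟨B, rfl⟩ := aux_sq hX
  obtain ⟨P, hP, hP1, hSP, hr⟩ := aux_proj_s9 (hC.mul_mul_conjTranspose_same B).isHermitian
  refine ⟨Bᴴ * P * B, hP.conjTranspose_mul_mul_same B, ?_, ?_, ?_⟩
  · calc _ ≤ (Bᴴ * P).rank := rank_mul_le_left _ _
      _ ≤ P.rank := rank_mul_le_right _ _
      _ ≤ _ := hr
      _ ≤ (B * C).rank := rank_mul_le_left _ _
      _ ≤ _ := rank_mul_le_right _ _
  · calc _ = (B * C * Bᴴ * P).trace := by
          rw [← Matrix.mul_assoc, Matrix.trace_mul_comm]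
          simp only [Matrix.mul_assoc]
      _ = (B * (C * Bᴴ)).trace := by rw [hSP, Matrix.mul_assoc]
      _ = _ := by rw [Matrix.trace_mul_comm, Matrix.mul_assoc]
  · intro M hM
    have h1 := aux_tr_s9 hM (hP1.conjTranspose_mul_mul_same B)
    rw [Matrix.mul_sub, Matrix.sub_mul, Matrix.mul_one, Matrix.mul_sub, trace_sub] at h1
    linarith

/-- If the combined semidefinite packing problem (P_CMB) and its dual are feasible and
`rank C = r`, then there is a sequence of feasible triples `(X k, Y k, λ k)` with
`rank (X k) ≤ r` whose objective values converge to the supremum of the objective. -/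
theorem stmt_9 (n p q l r : ℕ)
    (C : Matrix (Fin n) (Fin n) ℝ) (M : Fin l → Matrix (Fin n) (Fin n) ℝ)
    (R0 : Matrix (Fin p) (Fin p) ℝ) (R : Fin l → Matrix (Fin p) (Fin p) ℝ)
    (h0 : Fin q → ℝ) (h : Fin l → Fin q → ℝ) (b : Fin l → ℝ)
    (hC : C.PosSemidef) (hM : ∀ i, (M i).PosSemidef)
    (hR0 : R0.IsSymm) (hR : ∀ i, (R i).IsSymm)
    (hfeas : ∃ (X : Matrix (Fin n) (Fin n) ℝ) (Y : Matrix (Fin p) (Fin p) ℝ)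
      (lam : Fin q → ℝ), X.PosSemidef ∧ Y.PosSemidef ∧
        ∀ i, (M i * X).trace ≤ b i + (R i * Y).trace + h i ⬝ᵥ lam)
    (hdual : ∃ μ : Fin l → ℝ, (∀ i, 0 ≤ μ i) ∧ ((∑ i, μ i • M i) - C).PosSemidef ∧
      (-(R0 + ∑ i, μ i • R i)).PosSemidef ∧ h0 + ∑ i, μ i • h i = 0)
    (hrank : C.rank = r) :
    ∃ (X : ℕ → Matrix (Fin n) (Fin n) ℝ) (Y : ℕ → Matrix (Fin p) (Fin p) ℝ)
      (lam : ℕ → Fin q → ℝ),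
      (∀ k, (X k).PosSemidef ∧ (Y k).PosSemidef ∧
        ∀ i, (M i * X k).trace ≤ b i + (R i * Y k).trace + h i ⬝ᵥ lam k) ∧
      (∀ k, (X k).rank ≤ r) ∧
      Tendsto (fun k => (C * X k).trace + (R0 * Y k).trace + h0 ⬝ᵥ lam k) atTop
        (nhds (sSup {t : ℝ | ∃ (X' : Matrix (Fin n) (Fin n) ℝ)
          (Y' : Matrix (Fin p) (Fin p) ℝ) (lam' : Fin q → ℝ),
          X'.PosSemidef ∧ Y'.PosSemidef ∧
          (∀ i, (M i * X').trace ≤ b i + (R i * Y').trace + h i ⬝ᵥ lam') ∧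
          t = (C * X').trace + (R0 * Y').trace + h0 ⬝ᵥ lam'})) := by
  classical
  set T := {t : ℝ | ∃ (X' : Matrix (Fin n) (Fin n) ℝ)
          (Y' : Matrix (Fin p) (Fin p) ℝ) (lam' : Fin q → ℝ),
          X'.PosSemidef ∧ Y'.PosSemidef ∧
          (∀ i, (M i * X').trace ≤ b i + (R i * Y').trace + h i ⬝ᵥ lam') ∧
          t = (C * X').trace + (R0 * Y').trace + h0 ⬝ᵥ lam'} with hT
  have hne : T.Nonempty := by
    obtain ⟨X, Y, lam, hX, hY, hc⟩ := hfeas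
    exact ⟨_, X, Y, lam, hX, hY, hc, rfl⟩
  have hbd : BddAbove T := by
    obtain ⟨μ, hμ, h1, h2, h3⟩ := hdual
    refine ⟨∑ i, μ i * b i, ?_⟩
    rintro t ⟨X, Y, lam, hX, hY, hc, rfl⟩
    have a1 := aux_tr_s9 h1 hX
    have a2 := aux_tr_s9 h2 hY
    have a3 : (h0 + ∑ i, μ i • h i) ⬝ᵥ lam = 0 := by rw [h3]; simp
    have a4 : ∑ i, μ i * (M i * X).trace
        ≤ ∑ i, μ i * (b i + (R i * Y).trace + h i ⬝ᵥ lam) :=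
      Finset.sum_le_sum fun i _ => mul_le_mul_of_nonneg_left (hc i) (hμ i)
    simp only [mul_add, Finset.sum_add_distrib] at a4
    rw [Matrix.sub_mul, trace_sub, Finset.sum_mul, trace_sum] at a1
    rw [Matrix.neg_mul, trace_neg, Matrix.add_mul, trace_add, Finset.sum_mul, trace_sum] at a2
    rw [add_dotProduct, sum_dotProduct] at a3
    simp only [smul_mul, trace_smul, smul_eq_mul, smul_dotProduct] at a1 a2 a3
    linarith
  obtain ⟨u, -, hu, huT⟩ := exists_seq_tendsto_sSup hne hbd
  have key : ∀ k, ∃ (X : Matrix (Fin n) (Fin n) ℝ) (Y : Matrix (Fin p) (Fin p) ℝ)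
      (lam : Fin q → ℝ), (X.PosSemidef ∧ Y.PosSemidef ∧
        ∀ i, (M i * X).trace ≤ b i + (R i * Y).trace + h i ⬝ᵥ lam) ∧ X.rank ≤ r ∧
        (C * X).trace + (R0 * Y).trace + h0 ⬝ᵥ lam = u k := by
    intro k
    obtain ⟨X, Y, lam, hX, hY, hc, ht⟩ := huT k
    obtain ⟨X', hX', hr, hCX, hMX⟩ := aux_red hC hX
    exact ⟨X', Y, lam, ⟨hX', hY, fun i => (hMX _ (hM i)).trans (hc i)⟩, hrank ▸ hr,
      by rw [hCX, ht]⟩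
  choose X Y lam h1 h2 h3 using key
  refine ⟨X, Y, lam, h1, h2, ?_⟩
  simpa only [h3] using hu
end

section
/- Let h_0, h_1, …, h_l be vectors in ℝ^q, let K := {Σ_{i=0}^l v_i h_i : v_i ≥ 0 for all i} be the convex cone they generate, and let L := K ∩ (−K) be its lineality space. Then there exists a vector λ_0 ∈ ℝ^q such that λ_0ᵀh_i = 0 for every index i with h_i ∈ L, and λ_0ᵀh_i > 0 for every index i with h_i ∉ L. -/
open Matrix

/-- The convex cone generated by the vectors `h 0, …, h l` in `ℝ^q`. -/
def coneGen {q m : ℕ} (h : Fin m → Fin q → ℝ) : Set (Fin q → ℝ) :=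
  {x | ∃ v : Fin m → ℝ, (∀ j, 0 ≤ v j) ∧ x = ∑ j, v j • h j}

lemma coneGen_add {q m : ℕ} {h : Fin m → Fin q → ℝ} {x y : Fin q → ℝ}
    (hx : x ∈ coneGen h) (hy : y ∈ coneGen h) : x + y ∈ coneGen h := by
  obtain ⟨v, hv, rfl⟩ := hx
  obtain ⟨w, hw, rfl⟩ := hy
  refine ⟨fun j => v j + w j, fun j => add_nonneg (hv j) (hw j), ?_⟩
  simp only [add_smul, Finset.sum_add_distrib]

lemma coneGen_smul {q m : ℕ} {h : Fin m → Fin q → ℝ} {x : Fin q → ℝ} {c : ℝ}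
    (hc : 0 ≤ c) (hx : x ∈ coneGen h) : c • x ∈ coneGen h := by
  obtain ⟨v, hv, rfl⟩ := hx
  refine ⟨fun j => c * v j, fun j => mul_nonneg hc (hv j), ?_⟩
  simp only [mul_smul, Finset.smul_sum]

lemma coneGen_zero {q m : ℕ} {h : Fin m → Fin q → ℝ} : (0 : Fin q → ℝ) ∈ coneGen h :=
  ⟨0, fun _ => le_rfl, by simp⟩

lemma coneGen_gen {q m : ℕ} {h : Fin m → Fin q → ℝ} (i : Fin m) : h i ∈ coneGen h := by
  refine ⟨Pi.single i 1, fun j => ?_, ?_⟩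
  · by_cases hj : j = i
    · subst hj; simp
    · simp [hj]
  · simp [Pi.single_apply]

/-- The lineality space. -/
def linSp {q m : ℕ} (h : Fin m → Fin q → ℝ) : Submodule ℝ (Fin q → ℝ) where
  carrier := coneGen h ∩ (-coneGen h)
  zero_mem' := ⟨coneGen_zero, by simpa using coneGen_zero⟩
  add_mem' := by
    rintro a b ⟨ha, ha'⟩ ⟨hb, hb'⟩
    refine ⟨coneGen_add ha hb, ?_⟩
    rw [Set.mem_neg] at *
    rw [neg_add]
    exact coneGen_add ha' hb'
  smul_mem' := by
    rintro c a ⟨ha, ha'⟩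
    rw [Set.mem_neg] at ha'
    rcases le_total 0 c with hc | hc
    · refine ⟨coneGen_smul hc ha, ?_⟩
      rw [Set.mem_neg, ← smul_neg]
      exact coneGen_smul hc ha'
    · have hc' : 0 ≤ -c := by linarith
      refine ⟨?_, ?_⟩
      · have := coneGen_smul hc' ha'
        simpa using this
      · rw [Set.mem_neg, ← neg_smul]
        exact coneGen_smul hc' ha

lemma not_neg_aux {q m : ℕ} {h : Fin m → Fin q → ℝ} {a b : Fin q → ℝ} {s t : ℝ}
    (hb : b ∈ coneGen h) (ha' : -a ∉ coneGen h)
    (hs : 0 < s) (ht : 0 ≤ t) : -(s • a + t • b) ∉ coneGen h := by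
  intro hn
  apply ha'
  have h1 := coneGen_smul (inv_nonneg.2 hs.le) (coneGen_add hn (coneGen_smul ht hb))
  have h2 : s⁻¹ • (-(s • a + t • b) + t • b) = -a := by
    rw [neg_add, neg_add_cancel_right, smul_neg, smul_smul, inv_mul_cancel₀ hs.ne', one_smul]
  rwa [h2] at h1

lemma convex_diff {q m : ℕ} (h : Fin m → Fin q → ℝ) :
    Convex ℝ {x | x ∈ coneGen h ∧ -x ∉ coneGen h} := by
  rintro a ⟨ha, ha'⟩ b ⟨hb, hb'⟩ s t hs ht hst
  refine ⟨coneGen_add (coneGen_smul hs ha) (coneGen_smul ht hb), ?_⟩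
  rcases hs.lt_or_eq with hs' | hs'
  · exact not_neg_aux hb ha' hs' ht
  · rw [add_comm]
    exact not_neg_aux ha hb' (by linarith) hs

/-- There is a vector `λ₀` that is orthogonal to every `h i` lying in the lineality space
`L = K ∩ (−K)` of the cone `K` generated by `h 0, …, h l`, and has positive inner product
with every `h i` outside `L`. -/
theorem stmt_14 (q l : ℕ) (h : Fin (l + 1) → Fin q → ℝ) :
    ∃ lam0 : Fin q → ℝ, ∀ i : Fin (l + 1),
      (h i ∈ coneGen h ∩ (-coneGen h) → lam0 ⬝ᵥ h i = 0) ∧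
      (h i ∉ coneGen h ∩ (-coneGen h) → 0 < lam0 ⬝ᵥ h i) := by
  set S : Set (Fin q → ℝ) := h '' {i | h i ∉ linSp h} with hS
  have hsub : convexHull ℝ S ⊆ {x | x ∈ coneGen h ∧ -x ∉ coneGen h} := by
    apply convexHull_min _ (convex_diff h)
    rintro _ ⟨i, hi, rfl⟩
    exact ⟨coneGen_gen i, fun hn => hi ⟨coneGen_gen i, hn⟩⟩
  have hdisj : Disjoint (linSp h : Set (Fin q → ℝ)) (convexHull ℝ S) := by
    rw [Set.disjoint_left]
    intro x hx hx'
    exact (hsub hx').2 hx.2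
  have hcomp : IsCompact (convexHull ℝ S) :=
    Set.Finite.isCompact_convexHull (𝕜 := ℝ) ((Set.toFinite _).image h)
  obtain ⟨f, u, v, hu, huv, hv⟩ := geometric_hahn_banach_closed_compact
    (linSp h).convex (linSp h).closed_of_finiteDimensional (convex_convexHull ℝ S) hcomp hdisj
  have hu0 : 0 < u := by simpa using hu 0 (linSp h).zero_mem
  have hf0 : ∀ x ∈ linSp h, f x = 0 := by
    intro x hx
    by_contra hne
    have := hu ((u / f x) • x) ((linSp h).smul_mem _ hx)
    rw [map_smul, smul_eq_mul, div_mul_cancel₀ _ hne] at this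
    exact lt_irrefl _ this
  have hrep : ∀ x, (fun j => f (Pi.single j 1)) ⬝ᵥ x = f x := by
    intro x
    conv_rhs => rw [pi_eq_sum_univ' x]
    simp only [map_sum, map_smul, smul_eq_mul, dotProduct]
    refine Finset.sum_congr rfl fun j _ => ?_
    rw [mul_comm]
  refine ⟨fun j => f (Pi.single j 1), fun i => ⟨fun hi => ?_, fun hi => ?_⟩⟩
  · rw [hrep]; exact hf0 _ hi
  · rw [hrep]
    have := hv (h i) (subset_convexHull ℝ S ⟨i, hi, rfl⟩)
    linarith
end

section
/- Consider the optimization problem: supremum, over 2×2 real symmetric positive semidefinite matrices X and λ = (λ₁,λ₂) ∈ ℝ², of (3/100)·⟨[[81,9],[9,1]], X⟩ − λ₁ − 3λ₂, subject to 0 ≤ 1 + λ₁, X₁₁ ≤ 1 + λ₂, and X₂₂ ≤ 1 + 3λ₁ + λ₂. The value of this supremum is 31/10, it is approached by the feasible sequence X_k = x_k x_kᵀ with x_k = (√(3+k), √k)ᵀ and λ_k = (−1, k+2)ᵀ for k ∈ ℕ, and it is not attained by any feasible pair (X, λ). -/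
open Matrix Filter

/-- Feasibility for the example combined semidefinite packing problem. -/
def feas15 (X : Matrix (Fin 2) (Fin 2) ℝ) (lam : Fin 2 → ℝ) : Prop :=
  X.PosSemidef ∧ 0 ≤ 1 + lam 0 ∧ X 0 0 ≤ 1 + lam 1 ∧ X 1 1 ≤ 1 + 3 * lam 0 + lam 1

/-- Objective of the example combined semidefinite packing problem. -/
noncomputable def obj15 (X : Matrix (Fin 2) (Fin 2) ℝ) (lam : Fin 2 → ℝ) : ℝ :=
  (3 / 100) * ((!![(81 : ℝ), 9; 9, 1]) * X).trace - lam 0 - 3 * lam 1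

theorem le_of_sq_le_sq_aux {x y : ℝ} (h : x ^ 2 ≤ y ^ 2) (hy : 0 ≤ y) : x ≤ y :=
  (le_abs_self x).trans (abs_le_of_sq_le_sq h hy)

theorem obj15_eq (X : Matrix (Fin 2) (Fin 2) ℝ) (lam : Fin 2 → ℝ) :
    obj15 X lam = (3 / 100) * (81 * X 0 0 + 9 * X 1 0 + (9 * X 0 1 + X 1 1))
      - lam 0 - 3 * lam 1 := by
  rw [obj15, Matrix.trace_fin_two, Matrix.mul_apply, Matrix.mul_apply]
  simp [Fin.sum_univ_two]

theorem aux15 (X : Matrix (Fin 2) (Fin 2) ℝ) (lam : Fin 2 → ℝ) (h : feas15 X lam) :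
    obj15 X lam < 31 / 10 := by
  obtain ⟨hX, h0, h1, h2⟩ := h
  have hs : X 1 0 = X 0 1 := by simpa using hX.1.apply 0 1
  have hd := hX.det_nonneg
  have ha : 0 ≤ X 0 0 := hX.diag_nonneg
  have hc : 0 ≤ X 1 1 := hX.diag_nonneg
  rw [Matrix.det_fin_two, hs] at hd
  have ho : obj15 X lam = (3 / 100) * (81 * X 0 0 + 18 * X 0 1 + X 1 1) - lam 0 - 3 * lam 1 := by
    rw [obj15_eq, hs]
    ring
  rw [ho]
  generalize X 0 0 = a at *
  generalize X 0 1 = b at *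
  generalize X 1 1 = c at *
  generalize lam 0 = p at *
  generalize lam 1 = q at *
  have hb : 2 * b ≤ a + c := by
    refine le_of_sq_le_sq_aux ?_ (by linarith)
    nlinarith [sq_nonneg (a - c)]
  by_contra hn
  have e1 : p = -1 := by linarith
  have e2 : a = 1 + q := by linarith
  have e3 : c = q - 2 := by linarith
  have e4 : b = q - 1 / 2 := by linarith
  subst e1 e2 e3 e4
  nlinarith

theorem aux15_feas (k : ℕ) : feas15
      (vecMulVec ![Real.sqrt (3 + (k : ℝ)), Real.sqrt (k : ℝ)]
        ![Real.sqrt (3 + (k : ℝ)), Real.sqrt (k : ℝ)]) ![(-1 : ℝ), (k : ℝ) + 2] := by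
  have h3 : (0 : ℝ) ≤ 3 + k := by positivity
  have hk : (0 : ℝ) ≤ k := by positivity
  refine ⟨?_, ?_, ?_, ?_⟩
  · simpa using Matrix.posSemidef_vecMulVec_self_star
      ![Real.sqrt (3 + (k : ℝ)), Real.sqrt (k : ℝ)]
  · simp
  · simp [vecMulVec_apply, Real.mul_self_sqrt h3]
    linarith
  · simp [vecMulVec_apply, Real.mul_self_sqrt hk]
    linarith

theorem aux15_tendsto : Tendsto (fun k : ℕ => obj15
      (vecMulVec ![Real.sqrt (3 + (k : ℝ)), Real.sqrt (k : ℝ)]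
        ![Real.sqrt (3 + (k : ℝ)), Real.sqrt (k : ℝ)]) ![(-1 : ℝ), (k : ℝ) + 2])
      atTop (nhds (31 / 10)) := by
  have hl : Tendsto (fun k : ℕ => (31 / 10 : ℝ) - (243 / 200) * (1 / ((k : ℝ) + 1)))
      atTop (nhds (31 / 10)) := by
    simpa using (tendsto_one_div_add_atTop_nhds_zero_nat (𝕜 := ℝ)).const_mul (243 / 200)
      |>.const_sub (31 / 10)
  refine tendsto_of_tendsto_of_tendsto_of_le_of_le hl tendsto_const_nhds ?_
    (fun k => (aux15 _ _ (aux15_feas k)).le)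
  intro k
  have h3 : (0 : ℝ) ≤ 3 + k := by positivity
  have hk : (0 : ℝ) ≤ k := by positivity
  have ho : obj15
      (vecMulVec ![Real.sqrt (3 + (k : ℝ)), Real.sqrt (k : ℝ)]
        ![Real.sqrt (3 + (k : ℝ)), Real.sqrt (k : ℝ)]) ![(-1 : ℝ), (k : ℝ) + 2]
      = 229 / 100 + 54 / 100 * (Real.sqrt (3 + (k : ℝ)) * Real.sqrt (k : ℝ) - k) := by
    have e1 := Real.mul_self_sqrt h3
    rw [obj15_eq]
    simp [vecMulVec_apply]
    linear_combination (243 / 100) * e1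
  simp only [ho]
  have hs : (Real.sqrt (3 + (k : ℝ)) * Real.sqrt (k : ℝ)) ^ 2 = (3 + k) * k := by
    rw [mul_pow, Real.sq_sqrt h3, Real.sq_sqrt hk]
  have hs0 : 0 ≤ Real.sqrt (3 + (k : ℝ)) * Real.sqrt (k : ℝ) := by positivity
  generalize Real.sqrt (3 + (k : ℝ)) * Real.sqrt (k : ℝ) = s at *
  have hle : s ≤ k + 3 / 2 := by
    refine le_of_sq_le_sq_aux ?_ (by linarith)
    nlinarith
  have : (k : ℝ) + 3 / 2 - s ≤ (9 / 4) * (1 / ((k : ℝ) + 1)) := by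
    rw [mul_one_div, le_div_iff₀ (by positivity)]
    nlinarith [mul_nonneg (sub_nonneg.2 hle) hs0]
  linarith

/-- The example problem has value `31/10`, approached by the feasible sequence
`X_k = x_k x_kᵀ`, `x_k = (√(3+k), √k)`, `λ_k = (−1, k+2)`, but the supremum is not
attained by any feasible pair. -/
theorem stmt_15 :
    sSup {t : ℝ | ∃ (X : Matrix (Fin 2) (Fin 2) ℝ) (lam : Fin 2 → ℝ),
        feas15 X lam ∧ t = obj15 X lam} = 31 / 10 ∧
    (∀ k : ℕ, feas15
      (vecMulVec ![Real.sqrt (3 + (k : ℝ)), Real.sqrt (k : ℝ)]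
        ![Real.sqrt (3 + (k : ℝ)), Real.sqrt (k : ℝ)]) ![(-1 : ℝ), (k : ℝ) + 2]) ∧
    Tendsto (fun k : ℕ => obj15
      (vecMulVec ![Real.sqrt (3 + (k : ℝ)), Real.sqrt (k : ℝ)]
        ![Real.sqrt (3 + (k : ℝ)), Real.sqrt (k : ℝ)]) ![(-1 : ℝ), (k : ℝ) + 2])
      atTop (nhds (31 / 10)) ∧
    ¬∃ (X : Matrix (Fin 2) (Fin 2) ℝ) (lam : Fin 2 → ℝ),
      feas15 X lam ∧ obj15 X lam = 31 / 10 := by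
  refine ⟨?_, aux15_feas, aux15_tendsto, ?_⟩
  · apply IsLUB.csSup_eq
    · constructor
      · rintro t ⟨X, lam, h, rfl⟩
        exact (aux15 X lam h).le
      · intro u hu
        exact le_of_tendsto' aux15_tendsto (fun k => hu ⟨_, _, aux15_feas k, rfl⟩)
    · exact ⟨_, _, _, aux15_feas 0, rfl⟩
  · rintro ⟨X, lam, h, he⟩
    exact (aux15 X lam h).ne he
end
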